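/- Let k ∈ ℝ. There exists a constant C > 0 (depending only on k) such that for every r ∈ ℝ³, every δ with 0 < δ ≤ 1, every measurable F : ℝ³ → ℂ with |F(y)| ≤ M on B(r, δ), and all unit vectors v, w ∈ ℝ³: the function y ↦ D²g̃(r − y)(v, w)·F(y) is integrable on B(r, δ) and |∫_{B(r,δ)} D²g̃(r − y)(v, w) · F(y) dy| ≤ C·M·δ². (This is the correction-term estimate |∫_{V_δ} Δε ∇∇g̃ · E| ≤ C₂‖ΔεE‖_∞ δ² for a spherical exclusion volume V_δ.) -/

import Mathlib

open MeasureTheory Metric Real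

noncomputable def gReg (k : ℝ) (y : EuclideanSpace ℝ (Fin 3)) : ℂ :=
  (Complex.exp (-Complex.I * k * ‖y‖) - 1) / (4 * π * ‖y‖)

section RadialFunctions

variable {E : Type*} [NormedAddCommGroup E] [InnerProductSpace ℝ E]

lemma hasFDerivAt_norm_of_ne_zero {x : E} (hx : x ≠ 0) :
    HasFDerivAt (fun y : E => ‖y‖) (‖x‖⁻¹ • innerSL ℝ x) x := by
  have h := (hasStrictFDerivAt_norm_sq x).hasFDerivAt.sqrt (pow_ne_zero 2 (norm_ne_zero_iff.2 hx))
  simp only [Real.sqrt_sq (norm_nonneg _)] at h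
  refine h.congr_fderiv ?_
  ext v
  simp
  ring

/-- The real inner product, regarded as a bilinear map with complex values. -/
noncomputable def complexInnerSL (E : Type*) [NormedAddCommGroup E] [InnerProductSpace ℝ E] :
    E →L[ℝ] E →L[ℝ] ℂ :=
  (ContinuousLinearMap.compL ℝ E ℝ ℂ Complex.ofRealCLM).comp (innerSL ℝ)

@[simp]
lemma complexInnerSL_apply_apply (x v : E) : complexInnerSL E x v = (inner ℝ x v : ℝ) := rfl

lemma norm_complexInnerSL_apply_apply_le (x v : E) : ‖complexInnerSL E x v‖ ≤ ‖x‖ * ‖v‖ := by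
  simpa using abs_real_inner_le_norm x v

lemma hasFDerivAt_comp_norm {φ : ℝ → ℂ} {φ' : ℂ} {x : E} (hφ : HasDerivAt φ φ' ‖x‖)
    (hx : x ≠ 0) :
    HasFDerivAt (fun y : E => φ ‖y‖) ((φ' / ‖x‖) • complexInnerSL E x) x := by
  refine (hφ.hasFDerivAt.comp x (hasFDerivAt_norm_of_ne_zero hx)).congr_fderiv ?_
  ext v
  simp
  ring

lemma fderiv_fderiv_comp_norm_apply {φ φ' φ'' : ℝ → ℂ} (hφ : ∀ t, HasDerivAt φ (φ' t) t)
    (hφ' : ∀ t, HasDerivAt φ' (φ'' t) t) {x : E} (hx : x ≠ 0) (v w : E) :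
    fderiv ℝ (fderiv ℝ fun y : E => φ ‖y‖) x v w =
      φ' ‖x‖ / ‖x‖ * complexInnerSL E v w +
        (φ'' ‖x‖ * ‖x‖ - φ' ‖x‖) / ‖x‖ ^ 2 / ‖x‖ * complexInnerSL E x v *
          complexInnerSL E x w := by
  have hev : (fderiv ℝ fun y : E => φ ‖y‖) =ᶠ[nhds x]
      fun y => (φ' ‖y‖ / ‖y‖) • complexInnerSL E y := by
    filter_upwards [isOpen_ne.mem_nhds hx] with y hy
    exact (hasFDerivAt_comp_norm (hφ _) hy).fderiv
  have hne : ((‖x‖ : ℝ) : ℂ) ≠ 0 := by simpa using hx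
  have hq : HasDerivAt (fun t : ℝ => φ' t / t) ((φ'' ‖x‖ * ‖x‖ - φ' ‖x‖) / ‖x‖ ^ 2) ‖x‖ := by
    simpa using! (hφ' ‖x‖).div Complex.ofRealCLM.hasDerivAt hne
  have h := (hasFDerivAt_comp_norm hq hx).smul (complexInnerSL E).hasFDerivAt
  rw [hev.fderiv_eq]
  refine (congrArg (fun L => L v w) h.fderiv).trans ?_
  simp

lemma norm_fderiv_fderiv_comp_norm_apply_le {φ φ' φ'' : ℝ → ℂ}
    (hφ : ∀ t, HasDerivAt φ (φ' t) t) (hφ' : ∀ t, HasDerivAt φ' (φ'' t) t) {x : E} (hx : x ≠ 0)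
    (v w : E) :
    ‖fderiv ℝ (fderiv ℝ fun y : E => φ ‖y‖) x v w‖ ≤
      (‖φ'' ‖x‖‖ * ‖x‖ + 2 * ‖φ' ‖x‖‖) * ‖x‖⁻¹ * (‖v‖ * ‖w‖) := by
  have hpos : 0 < ‖x‖ := norm_pos_iff.2 hx
  rw [fderiv_fderiv_comp_norm_apply hφ hφ' hx]
  refine (norm_add_le _ _).trans ?_
  simp only [norm_mul, norm_div, norm_pow, Complex.norm_real, norm_norm]
  have h₁ : ‖φ'' ‖x‖ * ‖x‖ - φ' ‖x‖‖ ≤ ‖φ'' ‖x‖‖ * ‖x‖ + ‖φ' ‖x‖‖ := by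
    simpa using norm_sub_le (φ'' ‖x‖ * ‖x‖) (φ' ‖x‖)
  calc
    _ ≤ ‖φ' ‖x‖‖ / ‖x‖ * (‖v‖ * ‖w‖) +
        (‖φ'' ‖x‖‖ * ‖x‖ + ‖φ' ‖x‖‖) / ‖x‖ ^ 2 / ‖x‖ * (‖x‖ * ‖v‖) * (‖x‖ * ‖w‖) := by
      gcongr <;> exact norm_complexInnerSL_apply_apply_le _ _
    _ = _ := by
      field_simp
      ring

end RadialFunctions

/-- The entire function whose value at `t ≠ 0` is `(exp (-i k t) - 1) / (4 π t)`. -/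
noncomputable def gRegProfile (k : ℝ) (z : ℂ) : ℂ :=
  dslope (fun z : ℂ => Complex.exp (-Complex.I * k * z)) 0 z / (4 * π)

lemma differentiable_gRegProfile (k : ℝ) : Differentiable ℂ (gRegProfile k) := by
  have h : Differentiable ℂ (dslope (fun z : ℂ => Complex.exp (-Complex.I * k * z)) 0) := by
    rw [← differentiableOn_univ, Complex.differentiableOn_dslope Filter.univ_mem]
    fun_prop
  exact h.div_const _

lemma gReg_eq_gRegProfile (k : ℝ) {y : EuclideanSpace ℝ (Fin 3)} (hy : y ≠ 0) :
    gReg k y = gRegProfile k ‖y‖ := by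
  have hne : ((‖y‖ : ℝ) : ℂ) ≠ 0 := by simpa using hy
  rw [gReg, gRegProfile, dslope_of_ne _ hne, slope_def_field]
  simp only [mul_zero, Complex.exp_zero, sub_zero]
  rw [div_div, mul_comm (4 * (π : ℂ))]

lemma exists_norm_fderiv_fderiv_gReg_le (k : ℝ) :
    ∃ A : ℝ, 0 < A ∧ ∀ x : EuclideanSpace ℝ (Fin 3), x ≠ 0 → ‖x‖ ≤ 1 →
      ∀ v w, ‖fderiv ℝ (fderiv ℝ (gReg k)) x v w‖ ≤ A * ‖x‖⁻¹ * (‖v‖ * ‖w‖) := by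
  have h₀ := differentiable_gRegProfile k
  have h₁ : Differentiable ℂ (deriv (gRegProfile k)) := h₀.deriv
  have h₂ : Differentiable ℂ (deriv (deriv (gRegProfile k))) := h₁.deriv
  obtain ⟨B₁, hB₁⟩ := (isCompact_closedBall (0 : ℂ) 1).exists_bound_of_continuousOn
    h₁.continuous.continuousOn
  obtain ⟨B₂, hB₂⟩ := (isCompact_closedBall (0 : ℂ) 1).exists_bound_of_continuousOn
    h₂.continuous.continuousOn
  have hB₁0 : 0 ≤ B₁ := (norm_nonneg _).trans (hB₁ 0 (by simp))
  have hB₂0 : 0 ≤ B₂ := (norm_nonneg _).trans (hB₂ 0 (by simp))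
  refine ⟨B₂ + 2 * B₁ + 1, by positivity, fun x hx hx1 v w => ?_⟩
  have hmem : ((‖x‖ : ℝ) : ℂ) ∈ closedBall (0 : ℂ) 1 := by simpa using hx1
  have hev : gReg k =ᶠ[nhds x] fun y => gRegProfile k ‖y‖ := by
    filter_upwards [isOpen_ne.mem_nhds hx] with y hy
    exact gReg_eq_gRegProfile k hy
  rw [hev.fderiv.fderiv_eq]
  refine (norm_fderiv_fderiv_comp_norm_apply_le
    (φ := fun t => gRegProfile k t) (φ' := fun t => deriv (gRegProfile k) t)
    (φ'' := fun t => deriv (deriv (gRegProfile k)) t)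
    (fun t => (h₀ t).hasDerivAt.comp_ofReal) (fun t => (h₁ t).hasDerivAt.comp_ofReal)
    hx v w).trans ?_
  have h := mul_le_mul (hB₂ _ hmem) hx1 (norm_nonneg x) hB₂0
  refine mul_le_mul_of_nonneg_right (mul_le_mul_of_nonneg_right ?_ (by positivity))
    (by positivity)
  linarith [hB₁ _ hmem]

lemma indicator_ball_inv_norm_sub {E : Type*} [NormedAddCommGroup E] (r : E) (δ : ℝ) :
    (ball r δ).indicator (fun y => ‖r - y‖⁻¹) =
      fun y => (Set.Iio δ).indicator (fun t : ℝ => t⁻¹) ‖r - y‖ := by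
  ext y
  simp [Set.indicator, dist_eq_norm, norm_sub_rev y r]

lemma integrableOn_inv_norm_sub_ball (r : EuclideanSpace ℝ (Fin 3)) (δ : ℝ) :
    IntegrableOn (fun y => ‖r - y‖⁻¹) (ball r δ) := by
  rw [← integrable_indicator_iff measurableSet_ball, indicator_ball_inv_norm_sub]
  refine Integrable.comp_sub_left
    (f := fun z : EuclideanSpace ℝ (Fin 3) => (Set.Iio δ).indicator (fun t : ℝ => t⁻¹) ‖z‖) ?_ r
  have h : IntegrableOn (fun z : EuclideanSpace ℝ (Fin 3) => ‖z‖⁻¹) (ball 0 δ) := by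
    rw [integrableOn_fun_norm_addHaar volume (f := fun t : ℝ => t⁻¹), finrank_euclideanSpace_fin]
    have hid : IntegrableOn (fun t : ℝ => t) (Set.Ioo 0 δ) :=
      (continuous_id.integrableOn_Icc).mono_set Set.Ioo_subset_Icc_self
    refine hid.congr_fun (fun t ht => ?_) measurableSet_Ioo
    have := ht.1.ne'
    simp only [Nat.reduceSub, smul_eq_mul]
    field_simp
  rw [← integrable_indicator_iff measurableSet_ball] at h
  refine h.congr (Filter.Eventually.of_forall fun z => ?_)
  simp [Set.indicator]

lemma setIntegral_inv_norm_sub_ball (r : EuclideanSpace ℝ (Fin 3)) {δ : ℝ} (hδ : 0 ≤ δ) :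
    ∫ y in ball r δ, ‖r - y‖⁻¹ =
      3 * volume.real (ball (0 : EuclideanSpace ℝ (Fin 3)) 1) * (δ ^ 2 / 2) := by
  rw [← integral_indicator measurableSet_ball, indicator_ball_inv_norm_sub,
    integral_sub_left_eq_self
      (fun z : EuclideanSpace ℝ (Fin 3) => (Set.Iio δ).indicator (fun t : ℝ => t⁻¹) ‖z‖) volume r,
    integral_fun_norm_addHaar, finrank_euclideanSpace_fin]
  have h : ∫ t in Set.Ioi (0 : ℝ), t ^ (3 - 1) • (Set.Iio δ).indicator (fun t : ℝ => t⁻¹) t =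
      δ ^ 2 / 2 := by
    calc
      _ = ∫ t in Set.Ioi (0 : ℝ), (Set.Iio δ).indicator (fun t : ℝ => t) t := by
        refine setIntegral_congr_fun measurableSet_Ioi fun t (ht : 0 < t) => ?_
        by_cases h : t < δ
        · simp only [Set.indicator, Set.mem_Iio, h, if_true, Nat.reduceSub, smul_eq_mul]
          field_simp
        · simp [h]
      _ = ∫ t in (0 : ℝ)..δ, t := by
        rw [setIntegral_indicator measurableSet_Iio, Set.Ioi_inter_Iio,
          intervalIntegral.integral_of_le hδ, integral_Ioc_eq_integral_Ioo]
      _ = δ ^ 2 / 2 := by simp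
  rw [h]
  simp
  ring

theorem regular_part_correction_estimate (k : ℝ) :
    ∃ C : ℝ, 0 < C ∧
      ∀ (r : EuclideanSpace ℝ (Fin 3)) (δ : ℝ), 0 < δ → δ ≤ 1 →
        ∀ (F : EuclideanSpace ℝ (Fin 3) → ℂ), Measurable F →
          ∀ M : ℝ, (∀ y ∈ Metric.ball r δ, ‖F y‖ ≤ M) →
            ∀ v w : EuclideanSpace ℝ (Fin 3), ‖v‖ = 1 → ‖w‖ = 1 →
              IntegrableOn
                (fun y => fderiv ℝ (fderiv ℝ (gReg k)) (r - y) v w * F y)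
                (Metric.ball r δ) volume ∧
              ‖∫ y in Metric.ball r δ,
                  fderiv ℝ (fderiv ℝ (gReg k)) (r - y) v w * F y‖ ≤ C * M * δ ^ 2 := by
  obtain ⟨A, hA, hbound⟩ := exists_norm_fderiv_fderiv_gReg_le k
  set V := volume.real (ball (0 : EuclideanSpace ℝ (Fin 3)) 1)
  have hV : 0 ≤ V := measureReal_nonneg
  refine ⟨A * (3 * V / 2) + 1, by positivity, fun r δ hδ hδ1 F hF M hM v w hv hw => ?_⟩
  have hM0 : 0 ≤ M := (norm_nonneg _).trans (hM r (mem_ball_self hδ))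
  have hmeas : Measurable fun y => fderiv ℝ (fderiv ℝ (gReg k)) (r - y) v w * F y := by
    have h : Measurable fun x => fderiv ℝ (fderiv ℝ (gReg k)) x v w :=
      (ContinuousLinearMap.measurable_apply w).comp
        (measurable_fderiv_apply_const ℝ (fderiv ℝ (gReg k)) v)
    exact (h.comp (measurable_const.sub measurable_id)).mul hF
  have hle : ∀ᵐ y ∂volume.restrict (ball r δ),
      ‖fderiv ℝ (fderiv ℝ (gReg k)) (r - y) v w * F y‖ ≤ A * M * ‖r - y‖⁻¹ := by
    filter_upwards [ae_restrict_mem measurableSet_ball,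
      ae_restrict_of_ae (Measure.ae_ne volume r)] with y hy hyr
    have hy1 : ‖r - y‖ ≤ 1 := by
      rw [← dist_eq_norm, dist_comm]
      exact (mem_ball.1 hy).le.trans hδ1
    have h := hbound (r - y) (sub_ne_zero.2 (Ne.symm hyr)) hy1 v w
    rw [hv, hw, mul_one, mul_one] at h
    calc
      _ = ‖fderiv ℝ (fderiv ℝ (gReg k)) (r - y) v w‖ * ‖F y‖ := norm_mul _ _
      _ ≤ A * ‖r - y‖⁻¹ * M := by gcongr; exact hM y hy
      _ = A * M * ‖r - y‖⁻¹ := by ring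
  have hint := (integrableOn_inv_norm_sub_ball r δ).const_mul (A * M)
  refine ⟨hint.mono' hmeas.aestronglyMeasurable hle, ?_⟩
  calc
    _ ≤ ∫ y in ball r δ, A * M * ‖r - y‖⁻¹ := norm_integral_le_of_norm_le hint hle
    _ = A * (3 * V / 2) * M * δ ^ 2 := by
      rw [integral_const_mul, setIntegral_inv_norm_sub_ball r hδ.le]
      ring
    _ ≤ (A * (3 * V / 2) + 1) * M * δ ^ 2 := by
      gcongr
      linarith
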